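/- arXiv:2005.03507 — 4 statements merged into one kernel-verified Lean document; each statement's English description precedes it below -/
import Mathlib

section
/- Under the stated assumptions, the operator 𝒜 + ℬ has at least one zero: there exists ϖ* = (x*, σ*, λ*) ∈ ℝ^n × ℝ^{mE} × ℝ^{mN} such that 0 ∈ 𝒜(ϖ*) + ℬ(ϖ*), i.e., 0 ∈ F(x*) + Λᵀλ* + N_Ω(x*), 0 = −ρ 𝑽 λ*, and 0 ∈ b̄ − Λ x* + ρ 𝑽ᵀ σ* + 𝑳 λ* + N_{ℝ^{mN}_{≥0}}(λ*). (Proposition 1(i).) -/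
open Matrix Filter
open scoped BigOperators

noncomputable section

/-- Block dot product on `∏ i, ℝ^{n_i}` (the Euclidean inner product on `ℝ^n`,
`n = n_1 + … + n_N`, after stacking). -/
def bdot {N : ℕ} {nd : Fin N → ℕ} (u v : ∀ i, Fin (nd i) → ℝ) : ℝ :=
  ∑ i, u i ⬝ᵥ v i

/-- Euclidean inner product on `ℝ^{m·K}` viewed as `Fin K → Fin m → ℝ`. -/
def mdot {K m : ℕ} (u v : Fin K → Fin m → ℝ) : ℝ := ∑ l, u l ⬝ᵥ v l

/-- Euclidean norm on the stacked space `∏ i, ℝ^{n_i}`. -/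
def bnorm {N : ℕ} {nd : Fin N → ℕ} (u : ∀ i, Fin (nd i) → ℝ) : ℝ := Real.sqrt (bdot u u)

/-- Euclidean norm on `ℝ^d`. -/
def vnorm {d : ℕ} (v : Fin d → ℝ) : ℝ := Real.sqrt (v ⬝ᵥ v)

/-- Normal cone to `C ⊆ ℝ^d` at `x`: empty when `x ∉ C`. -/
def nCone {d : ℕ} (C : Set (Fin d → ℝ)) (x : Fin d → ℝ) : Set (Fin d → ℝ) :=
  {u | x ∈ C ∧ ∀ y ∈ C, u ⬝ᵥ (y - x) ≤ 0}

/-- Normal cone to a subset of the stacked space `ℝ^n = ∏ i, ℝ^{n_i}`. -/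
def nConeB {N : ℕ} {nd : Fin N → ℕ} (C : Set (∀ i, Fin (nd i) → ℝ))
    (x : ∀ i, Fin (nd i) → ℝ) : Set (∀ i, Fin (nd i) → ℝ) :=
  {u | x ∈ C ∧ ∀ y ∈ C, bdot u (y - x) ≤ 0}

/-- Normal cone to a subset of `ℝ^{m·K}`. -/
def nConeM {K m : ℕ} (C : Set (Fin K → Fin m → ℝ)) (x : Fin K → Fin m → ℝ) :
    Set (Fin K → Fin m → ℝ) :=
  {u | x ∈ C ∧ ∀ y ∈ C, mdot u (y - x) ≤ 0}

/-- Nonnegative orthant `ℝ^{m·K}_{≥0}`. -/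
def posOrthM {K m : ℕ} : Set (Fin K → Fin m → ℝ) := {lam | ∀ i j, 0 ≤ lam i j}

/-- Nonnegative orthant `ℝ^m_{≥0}`. -/
def posOrthV {m : ℕ} : Set (Fin m → ℝ) := {v | ∀ j, 0 ≤ v j}

/-- `𝑽 λ = (V ⊗ I_m) λ`, acting blockwise. -/
def bigV {E N m : ℕ} (V : Matrix (Fin E) (Fin N) ℝ) (lam : Fin N → Fin m → ℝ) :
    Fin E → Fin m → ℝ := fun l => ∑ j, V l j • lam j

/-- `𝑽ᵀ σ = (Vᵀ ⊗ I_m) σ`, acting blockwise. -/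
def bigVT {E N m : ℕ} (V : Matrix (Fin E) (Fin N) ℝ) (σ : Fin E → Fin m → ℝ) :
    Fin N → Fin m → ℝ := fun i => ∑ l, V l i • σ l

/-- `𝑳 λ = (L ⊗ I_m) λ` where `L = VᵀV` is the graph Laplacian. -/
def bigL {E N m : ℕ} (V : Matrix (Fin E) (Fin N) ℝ) (lam : Fin N → Fin m → ℝ) :
    Fin N → Fin m → ℝ := bigVT V (bigV V lam)

/-- `Λᵀ λ` for the block-diagonal matrix `Λ = diag(A_1, …, A_N)`. -/
def lamT {N m : ℕ} {nd : Fin N → ℕ} (A : ∀ i, Matrix (Fin m) (Fin (nd i)) ℝ)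
    (lam : Fin N → Fin m → ℝ) : ∀ i, Fin (nd i) → ℝ := fun i => (A i)ᵀ *ᵥ lam i

/-- `Λ x` for the block-diagonal matrix `Λ = diag(A_1, …, A_N)`. -/
def lamB {N m : ℕ} {nd : Fin N → ℕ} (A : ∀ i, Matrix (Fin m) (Fin (nd i)) ℝ)
    (x : ∀ i, Fin (nd i) → ℝ) : Fin N → Fin m → ℝ := fun i => A i *ᵥ x i

/-- The product set `Ω = Ω_1 × ⋯ × Ω_N`. -/
def prodSet {N : ℕ} {nd : Fin N → ℕ} (Ω : ∀ i, Set (Fin (nd i) → ℝ)) :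
    Set (∀ i, Fin (nd i) → ℝ) := {x | ∀ i, x i ∈ Ω i}

/-- Feasible set `𝒳 = Ω ∩ {x : A x ≤ btot}`. -/
def feasSet {N m : ℕ} {nd : Fin N → ℕ} (Ω : ∀ i, Set (Fin (nd i) → ℝ))
    (A : ∀ i, Matrix (Fin m) (Fin (nd i)) ℝ) (btot : Fin m → ℝ) :
    Set (∀ i, Fin (nd i) → ℝ) :=
  {x | (∀ i, x i ∈ Ω i) ∧ ∀ j, (∑ i, A i *ᵥ x i) j ≤ btot j}

/-- `x*` is a variational GNE: it solves `VI(F, 𝒳)`. -/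
def isVGNE {N m : ℕ} {nd : Fin N → ℕ} (Ω : ∀ i, Set (Fin (nd i) → ℝ))
    (A : ∀ i, Matrix (Fin m) (Fin (nd i)) ℝ) (btot : Fin m → ℝ)
    (F : (∀ i, Fin (nd i) → ℝ) → ∀ i, Fin (nd i) → ℝ)
    (xs : ∀ i, Fin (nd i) → ℝ) : Prop :=
  xs ∈ feasSet Ω A btot ∧ ∀ x ∈ feasSet Ω A btot, 0 ≤ bdot (F xs) (x - xs)

/-- degree of node `i`: number of edges incident to `i` (= `|𝒩_i|`). -/
def deg {E N : ℕ} (V : Matrix (Fin E) (Fin N) ℝ) (i : Fin N) : ℕ :=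
  (Finset.univ.filter fun l => V l i ≠ 0).card

open scoped RealInnerProductSpace in
/-- A Lipschitz, strongly monotone variational inequality over a nonempty closed convex subset of
a Hilbert space is solvable. -/
theorem exists_variational_inequality_solution {H : Type*} [NormedAddCommGroup H]
    [InnerProductSpace ℝ H] [CompleteSpace H] {K : Set H} (hne : K.Nonempty) (hcl : IsClosed K)
    (hcv : Convex ℝ K) {G : H → H} {α ℓ : ℝ} (hα : 0 < α) (hℓ : 0 < ℓ)
    (hmono : ∀ x y, α * ‖x - y‖ ^ 2 ≤ ⟪G x - G y, x - y⟫)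
    (hlip : ∀ x y, ‖G x - G y‖ ≤ ℓ * ‖x - y‖) :
    ∃ x ∈ K, ∀ y ∈ K, 0 ≤ ⟪G x, y - x⟫ := by
  have hproj : ∀ u : H, ∃ v ∈ K, ∀ w ∈ K, ⟪u - v, w - v⟫ ≤ 0 := by
    intro u
    obtain ⟨v, hv, h⟩ := exists_norm_eq_iInf_of_complete_convex hne hcl.isComplete hcv u
    exact ⟨v, hv, (norm_eq_iInf_iff_real_inner_le_zero hcv hv).1 h⟩
  choose P hPK hP using hproj
  have hPlip : ∀ u v, ‖P u - P v‖ ≤ ‖u - v‖ := by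
    intro u v
    have h1 := hP u (P v) (hPK v)
    have h2 := hP v (P u) (hPK u)
    have h3 : ‖P u - P v‖ ^ 2 ≤ ⟪u - v, P u - P v⟫ := by
      rw [← real_inner_self_eq_norm_sq]
      simp only [inner_sub_left, inner_sub_right] at h1 h2 ⊢
      linarith
    have h4 := real_inner_le_norm (u - v) (P u - P v)
    by_contra! h
    nlinarith [norm_nonneg (u - v)]
  set γ : ℝ := α / ℓ ^ 2 with hγ
  have hγpos : 0 < γ := by positivity
  set c : ℝ := 1 - α ^ 2 / ℓ ^ 2 with hc
  have hstep : ∀ x y, ‖(x - γ • G x) - (y - γ • G y)‖ ≤ Real.sqrt c * ‖x - y‖ := by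
    intro x y
    have h1 : ‖(x - γ • G x) - (y - γ • G y)‖ ^ 2 ≤ c * ‖x - y‖ ^ 2 := by
      have e : (x - γ • G x) - (y - γ • G y) = (x - y) - γ • (G x - G y) := by
        rw [smul_sub]; abel
      rw [e, norm_sub_sq_real, inner_smul_right, real_inner_comm, norm_smul, Real.norm_eq_abs,
        abs_of_pos hγpos, mul_pow]
      have h2 : ‖G x - G y‖ ^ 2 ≤ ℓ ^ 2 * ‖x - y‖ ^ 2 := by
        rw [← mul_pow]; exact pow_le_pow_left₀ (norm_nonneg _) (hlip x y) 2
      have h3 := mul_le_mul_of_nonneg_left (hmono x y) hγpos.le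
      have h4 := mul_le_mul_of_nonneg_left h2 (sq_nonneg γ)
      have h5 : γ ^ 2 * (ℓ ^ 2 * ‖x - y‖ ^ 2) = α ^ 2 / ℓ ^ 2 * ‖x - y‖ ^ 2 := by
        rw [hγ]; field_simp
      have h6 : γ * (α * ‖x - y‖ ^ 2) = α ^ 2 / ℓ ^ 2 * ‖x - y‖ ^ 2 := by
        rw [hγ]; field_simp
      rw [hc]
      linarith
    have h7 := Real.sqrt_le_sqrt h1
    rwa [Real.sqrt_sq (norm_nonneg _), Real.sqrt_mul' _ (sq_nonneg _),
      Real.sqrt_sq (norm_nonneg _)] at h7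
  have hcontr : ContractingWith (Real.toNNReal (Real.sqrt c)) (fun x => P (x - γ • G x)) := by
    constructor
    · rw [Real.toNNReal_lt_one, Real.sqrt_lt' one_pos, hc]
      have : 0 < α ^ 2 / ℓ ^ 2 := by positivity
      linarith
    · refine LipschitzWith.of_dist_le_mul fun x y => ?_
      rw [dist_eq_norm, dist_eq_norm, Real.coe_toNNReal _ (Real.sqrt_nonneg _)]
      exact (hPlip _ _).trans (hstep x y)
  have hfix : P (_ - γ • G _) = _ := hcontr.fixedPoint_isFixedPt
  set x := ContractingWith.fixedPoint _ hcontr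
  refine ⟨x, hfix ▸ hPK _, fun y hy => ?_⟩
  have h := hP (x - γ • G x) y hy
  rw [hfix, sub_sub_cancel_left, inner_neg_left, inner_smul_left] at h
  simp only [conj_trivial] at h
  exact nonneg_of_mul_nonneg_right (by linarith) hγpos

/-- Lagrange multipliers for a convex program under Slater's condition: a nonnegative lower bound
for the objective on the feasible set extends to the Lagrangian on the ground set. -/
theorem exists_lagrange_multiplier {X ι : Type*} [AddCommGroup X] [Module ℝ X] [Fintype ι]
    {C : Set X} {φ : X → ℝ} {g : ι → X → ℝ} (hφ : ConvexOn ℝ C φ) (hg : ∀ j, ConvexOn ℝ C (g j))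
    (hslater : ∃ x ∈ C, ∀ j, g j x < 0) (hmin : ∀ x ∈ C, (∀ j, g j x ≤ 0) → 0 ≤ φ x) :
    ∃ μ : ι → ℝ, (∀ j, 0 ≤ μ j) ∧ ∀ x ∈ C, 0 ≤ φ x + ∑ j, μ j * g j x := by
  classical
  obtain ⟨x₀, hx₀, hgx₀⟩ := hslater
  let S : Set (ℝ × (ι → ℝ)) := {p | ∃ x ∈ C, φ x < p.1 ∧ ∀ j, g j x < p.2 j}
  have hSopen : IsOpen S := by
    have : S = ⋃ x ∈ C, {p : ℝ × (ι → ℝ) | φ x < p.1 ∧ ∀ j, g j x < p.2 j} := by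
      ext p
      simp only [S, Set.mem_iUnion, Set.mem_ofPred_eq, exists_prop]
    rw [this]
    refine isOpen_biUnion fun x _ => ?_
    simp only [Set.ofPred_and, Set.ofPred_forall]
    refine (isOpen_lt continuous_const continuous_fst).inter ?_
    exact isOpen_iInter_of_finite fun j => isOpen_lt continuous_const (by fun_prop)
  have hSconv : Convex ℝ S := by
    rintro p ⟨x, hx, hpx, hpg⟩ q ⟨y, hy, hqy, hqg⟩ a b ha hb hab
    refine ⟨a • x + b • y, hφ.1 hx hy ha hb hab, ?_, fun j => ?_⟩
    · refine (hφ.2 hx hy ha hb hab).trans_lt ?_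
      simp only [smul_eq_mul, Prod.fst_add, Prod.smul_fst]
      rcases ha.eq_or_lt with rfl | ha'
      · have : b = 1 := by linarith
        subst this; linarith
      · nlinarith
    · refine ((hg j).2 hx hy ha hb hab).trans_lt ?_
      have h1 := hpg j
      have h2 := hqg j
      simp only [smul_eq_mul, Prod.snd_add, Prod.smul_snd, Pi.add_apply, Pi.smul_apply]
      rcases ha.eq_or_lt with rfl | ha'
      · have : b = 1 := by linarith
        subst this; linarith
      · nlinarith
  have h0 : (0 : ℝ × (ι → ℝ)) ∉ S := by
    rintro ⟨x, hx, h1, h2⟩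
    exact absurd (hmin x hx fun j => (h2 j).le) (not_le.2 h1)
  obtain ⟨f, hf⟩ := geometric_hahn_banach_open_point hSconv hSopen h0
  rw [map_zero] at hf
  let ν₀ : ℝ := -f (1, 0)
  let ν : ι → ℝ := fun j => -f (0, Pi.single j 1)
  have hfrep : ∀ s t, f (s, t) = -(ν₀ * s + ∑ j, ν j * t j) := by
    intro s t
    have e : ((s, t) : ℝ × (ι → ℝ)) =
        s • ((1 : ℝ), (0 : ι → ℝ)) + ∑ j, t j • ((0 : ℝ), (Pi.single j 1 : ι → ℝ)) := by
      refine Prod.ext ?_ ?_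
      · simp [Prod.fst_sum]
      · ext k
        simp [Prod.snd_sum, Finset.sum_apply, Pi.single_apply]
    rw [e, map_add, map_smul, map_sum]
    simp only [map_smul, smul_eq_mul, ν₀, ν]
    rw [neg_add, ← Finset.sum_neg_distrib, neg_mul, neg_neg, mul_comm]
    congr 1
    exact Finset.sum_congr rfl fun j _ => by ring
  have hpos : ∀ x ∈ C, ∀ (s : ℝ) (t : ι → ℝ), φ x < s → (∀ j, g j x < t j) → 0 < ν₀ * s + ∑ j, ν j * t j := by
    intro x hx s t hs ht
    have := hf (s, t) ⟨x, hx, hs, ht⟩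
    rw [hfrep] at this
    linarith
  have hlag : ∀ x ∈ C, 0 ≤ ν₀ * φ x + ∑ j, ν j * g j x := by
    intro x hx
    have hcont : Filter.Tendsto
        (fun ε : ℝ => ν₀ * (φ x + ε) + ∑ j, ν j * (g j x + ε)) (nhdsWithin 0 (Set.Ioi 0))
        (nhds (ν₀ * (φ x + 0) + ∑ j, ν j * (g j x + 0))) :=
      (Continuous.tendsto (by fun_prop) 0).mono_left nhdsWithin_le_nhds
    simp only [add_zero] at hcont
    refine ge_of_tendsto hcont ?_
    filter_upwards [self_mem_nhdsWithin] with ε hε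
    have hε' : 0 < ε := hε
    exact (hpos x hx (φ x + ε) (fun j => g j x + ε) (by linarith) fun j => by linarith).le
  have hray : ∀ a c : ℝ, (∀ r : ℝ, 0 < r → 0 < c + r * a) → 0 ≤ a := by
    intro a c h
    by_contra! ha
    have h1 := h ((|c| + 1) / -a) (by have := neg_pos.2 ha; positivity)
    have h2 : (|c| + 1) / -a * a = -(|c| + 1) := by
      rw [div_neg, neg_mul, div_mul_cancel₀ _ ha.ne]
    linarith [le_abs_self c]
  have hν₀ : 0 ≤ ν₀ := by
    refine hray ν₀ (ν₀ * (φ x₀ + 1) + ∑ j, ν j * (g j x₀ + 1)) fun r hr => ?_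
    have := hpos x₀ hx₀ (φ x₀ + 1 + r) (fun j => g j x₀ + 1) (by linarith) fun j => by linarith
    linarith
  have hν : ∀ j, 0 ≤ ν j := by
    intro k
    refine hray (ν k) (ν₀ * (φ x₀ + 1) + ∑ j, ν j * (g j x₀ + 1)) fun r hr => ?_
    have := hpos x₀ hx₀ (φ x₀ + 1) (fun j => g j x₀ + 1 + Pi.single (M := fun _ => ℝ) k r j)
      (by linarith) fun j => by
        have : 0 ≤ Pi.single (M := fun _ => ℝ) k r j := by
          rw [Pi.single_apply]; split_ifs <;> linarith
        linarith
    simp only [mul_add, Finset.sum_add_distrib, Pi.single_apply, mul_ite, mul_zero,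
      Finset.sum_ite_eq', Finset.mem_univ, if_true] at this ⊢
    linarith
  have hν₀pos : 0 < ν₀ := by
    refine hν₀.lt_of_ne fun h => ?_
    have h1 := hlag x₀ hx₀
    rw [← h, zero_mul, zero_add] at h1
    have h2 : ∀ j ∈ Finset.univ, ν j * g j x₀ ≤ 0 := fun j _ =>
      mul_nonpos_of_nonneg_of_nonpos (hν j) (hgx₀ j).le
    have h3 := (Finset.sum_eq_zero_iff_of_nonpos h2).1 (le_antisymm (Finset.sum_nonpos h2) h1)
    have h4 : ∀ j, ν j = 0 := fun j =>
      (mul_eq_zero.1 (h3 j (Finset.mem_univ j))).resolve_right (hgx₀ j).ne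
    have h5 := hpos x₀ hx₀ (φ x₀ + 1) (fun j => g j x₀ + 1) (by linarith) fun j => by linarith
    simp [← h, h4] at h5
  refine ⟨fun j => ν j / ν₀, fun j => div_nonneg (hν j) hν₀, fun x hx => ?_⟩
  have e : φ x + ∑ j, ν j / ν₀ * g j x = (ν₀ * φ x + ∑ j, ν j * g j x) / ν₀ := by
    rw [add_div, mul_div_cancel_left₀ _ hν₀pos.ne', Finset.sum_div]
    congr 1
    exact Finset.sum_congr rfl fun j _ => by ring
  rw [e]
  exact div_nonneg (hlag x hx) hν₀

/-- A vector annihilating the kernel of a matrix lies in the range of its transpose. -/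
theorem exists_transpose_mulVec_eq {m n : Type*} [Fintype m] [Fintype n] [DecidableEq m]
    [DecidableEq n] (M : Matrix m n ℝ) (z : n → ℝ) (hz : ∀ y, M *ᵥ y = 0 → z ⬝ᵥ y = 0) :
    ∃ s : m → ℝ, Mᵀ *ᵥ s = z := by
  have hmem : dotProductBilin ℝ ℝ z ∈ LinearMap.range (M.mulVecLin).dualMap := by
    rw [LinearMap.range_dualMap_eq_dualAnnihilator_ker, Submodule.mem_dualAnnihilator]
    intro y hy
    exact hz y (by simpa using hy)
  obtain ⟨ψ, hψ⟩ := hmem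
  refine ⟨fun l => ψ (Pi.single l 1), ?_⟩
  ext i
  have h := LinearMap.congr_fun hψ (Pi.single i 1)
  simp only [LinearMap.dualMap_apply, Matrix.mulVecLin_apply, mulVec_single_one] at h
  have hz' : z i = ψ (M.col i) := by
    rw [h]; simp [dotProductBilin]
  rw [hz', ← Finset.univ_sum_single (M.col i), map_sum]
  simp only [mulVec, dotProduct, transpose_apply]
  refine Finset.sum_congr rfl fun l _ => ?_
  rw [← smul_eq_mul, ← map_smul, ← Pi.single_smul]
  simp [Matrix.col]

/-- Euclidean structure on the stacked space in which `bdot` is the inner product. -/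
abbrev StackedSpace {N : ℕ} (nd : Fin N → ℕ) : Type :=
  PiLp 2 fun i => EuclideanSpace ℝ (Fin (nd i))

/-- The underlying family of blocks of a stacked Euclidean vector. -/
def StackedSpace.blocks {N : ℕ} {nd : Fin N → ℕ} (u : StackedSpace nd) : ∀ i, Fin (nd i) → ℝ :=
  fun i => (u i).ofLp

/-- The stacked Euclidean vector with prescribed blocks. -/
def StackedSpace.ofBlocks {N : ℕ} {nd : Fin N → ℕ} (x : ∀ i, Fin (nd i) → ℝ) :
    StackedSpace nd := WithLp.toLp 2 fun i => WithLp.toLp 2 (x i)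

theorem StackedSpace.inner_eq_bdot {N : ℕ} {nd : Fin N → ℕ} (u v : StackedSpace nd) :
    inner ℝ u v = bdot u.blocks v.blocks := by
  simp [PiLp.inner_apply, bdot, blocks, dotProduct, mul_comm]

theorem StackedSpace.norm_eq_bnorm {N : ℕ} {nd : Fin N → ℕ} (u : StackedSpace nd) :
    ‖u‖ = bnorm u.blocks := by
  rw [norm_eq_sqrt_real_inner, inner_eq_bdot, bnorm]

theorem StackedSpace.continuous_blocks {N : ℕ} {nd : Fin N → ℕ} :
    Continuous (StackedSpace.blocks (nd := nd)) := by
  unfold blocks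
  fun_prop

/-- A strongly monotone Lipschitz game has a variational equilibrium on any nonempty closed convex
set of the stacked space. -/
theorem exists_bdot_variational_inequality_solution {N : ℕ} {nd : Fin N → ℕ}
    {K : Set (∀ i, Fin (nd i) → ℝ)} (hne : K.Nonempty) (hcl : IsClosed K) (hcv : Convex ℝ K)
    {F : (∀ i, Fin (nd i) → ℝ) → ∀ i, Fin (nd i) → ℝ} {α ℓ : ℝ} (hα : 0 < α) (hℓ : 0 < ℓ)
    (hmono : ∀ x y, α * bdot (x - y) (x - y) ≤ bdot (F x - F y) (x - y))
    (hlip : ∀ x y, bnorm (F x - F y) ≤ ℓ * bnorm (x - y)) :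
    ∃ x ∈ K, ∀ y ∈ K, 0 ≤ bdot (F x) (y - x) := by
  obtain ⟨x₀, hx₀⟩ := hne
  obtain ⟨x, hx, hvi⟩ := exists_variational_inequality_solution
    (K := StackedSpace.blocks ⁻¹' K) (G := fun u => StackedSpace.ofBlocks (F u.blocks))
    ⟨StackedSpace.ofBlocks x₀, hx₀⟩ (hcl.preimage StackedSpace.continuous_blocks)
    (fun u hu v hv a b ha hb hab => hcv hu hv ha hb hab) hα hℓ
    (fun u v => by
      rw [← real_inner_self_eq_norm_sq, StackedSpace.inner_eq_bdot, StackedSpace.inner_eq_bdot]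
      exact hmono u.blocks v.blocks)
    (fun u v => by
      rw [StackedSpace.norm_eq_bnorm, StackedSpace.norm_eq_bnorm]
      exact hlip u.blocks v.blocks)
  refine ⟨x.blocks, hx, fun y hy => ?_⟩
  have h := hvi (StackedSpace.ofBlocks y) hy
  rwa [StackedSpace.inner_eq_bdot] at h

theorem isClosed_feasSet {N m : ℕ} {nd : Fin N → ℕ} {Ω : ∀ i, Set (Fin (nd i) → ℝ)}
    (hΩ : ∀ i, IsClosed (Ω i)) (A : ∀ i, Matrix (Fin m) (Fin (nd i)) ℝ) (btot : Fin m → ℝ) :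
    IsClosed (feasSet Ω A btot) := by
  simp only [feasSet, Set.ofPred_and, Set.ofPred_forall]
  refine (isClosed_iInter fun i => (hΩ i).preimage (continuous_apply i)).inter
    (isClosed_iInter fun j => isClosed_le ?_ continuous_const)
  simp only [Finset.sum_apply]
  exact continuous_finsetSum _ fun i _ =>
    (continuous_apply j).comp ((continuous_const (y := A i)).matrix_mulVec (continuous_apply i))

theorem convex_prodSet {N : ℕ} {nd : Fin N → ℕ} {Ω : ∀ i, Set (Fin (nd i) → ℝ)}
    (hΩ : ∀ i, Convex ℝ (Ω i)) : Convex ℝ (prodSet Ω) :=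
  fun _ hx _ hy _ _ ha hb hab i => hΩ i (hx i) (hy i) ha hb hab

/-- An affine function is convex, in the form of a function respecting convex combinations. -/
theorem convexOn_of_map_combo_eq {X : Type*} [AddCommGroup X] [Module ℝ X] {C : Set X}
    (hC : Convex ℝ C) {φ : X → ℝ}
    (h : ∀ x y (a b : ℝ), a + b = 1 → φ (a • x + b • y) = a * φ x + b * φ y) : ConvexOn ℝ C φ :=
  ⟨hC, fun x _ y _ a b _ _ hab => (h x y a b hab).le⟩

theorem sum_mulVec_combo {N m : ℕ} {nd : Fin N → ℕ} (A : ∀ i, Matrix (Fin m) (Fin (nd i)) ℝ)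
    (x y : ∀ i, Fin (nd i) → ℝ) (a b : ℝ) :
    ∑ i, A i *ᵥ (a • x + b • y) i = a • ∑ i, A i *ᵥ x i + b • ∑ i, A i *ᵥ y i := by
  simp only [Pi.add_apply, Pi.smul_apply, mulVec_add, mulVec_smul, Finset.sum_add_distrib,
    Finset.smul_sum]

theorem convex_feasSet {N m : ℕ} {nd : Fin N → ℕ} {Ω : ∀ i, Set (Fin (nd i) → ℝ)}
    (hΩ : ∀ i, Convex ℝ (Ω i)) (A : ∀ i, Matrix (Fin m) (Fin (nd i)) ℝ) (btot : Fin m → ℝ) :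
    Convex ℝ (feasSet Ω A btot) := by
  rintro x ⟨hx, hAx⟩ y ⟨hy, hAy⟩ a b ha hb hab
  refine ⟨convex_prodSet hΩ hx hy ha hb hab, fun j => ?_⟩
  rw [sum_mulVec_combo]
  have h1 := mul_le_mul_of_nonneg_left (hAx j) ha
  have h2 := mul_le_mul_of_nonneg_left (hAy j) hb
  simp only [Pi.add_apply, Pi.smul_apply, smul_eq_mul]
  calc _ ≤ a * btot j + b * btot j := add_le_add h1 h2
    _ = btot j := by rw [← add_mul, hab, one_mul]

theorem bdot_combo {N : ℕ} {nd : Fin N → ℕ} (u x y : ∀ i, Fin (nd i) → ℝ) (a b : ℝ) :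
    bdot u (a • x + b • y) = a * bdot u x + b * bdot u y := by
  simp only [bdot, Pi.add_apply, Pi.smul_apply, dotProduct_add, dotProduct_smul,
    Finset.sum_add_distrib, Finset.mul_sum, smul_eq_mul]

theorem bdot_sub_right {N : ℕ} {nd : Fin N → ℕ} (u x y : ∀ i, Fin (nd i) → ℝ) :
    bdot u (x - y) = bdot u x - bdot u y := by
  simp [bdot, dotProduct_sub, Finset.sum_sub_distrib]

theorem bdot_sub_left {N : ℕ} {nd : Fin N → ℕ} (u v x : ∀ i, Fin (nd i) → ℝ) :
    bdot (u - v) x = bdot u x - bdot v x := by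
  simp [bdot, sub_dotProduct, Finset.sum_sub_distrib]

theorem bdot_neg_left {N : ℕ} {nd : Fin N → ℕ} (u x : ∀ i, Fin (nd i) → ℝ) :
    bdot (-u) x = -bdot u x := by
  simp [bdot, neg_dotProduct]

theorem bdot_lamT_const {N m : ℕ} {nd : Fin N → ℕ} (A : ∀ i, Matrix (Fin m) (Fin (nd i)) ℝ)
    (μ : Fin m → ℝ) (x : ∀ i, Fin (nd i) → ℝ) :
    bdot (lamT A fun _ => μ) x = μ ⬝ᵥ ∑ i, A i *ᵥ x i := by
  simp only [bdot, lamT, dotProduct_sum]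
  exact Finset.sum_congr rfl fun i _ => by rw [mulVec_transpose, dotProduct_mulVec]

/-- Karush–Kuhn–Tucker conditions for the variational equilibrium of a game with affine coupling
constraints satisfying Slater's condition. -/
theorem isVGNE.exists_multiplier {N m : ℕ} {nd : Fin N → ℕ} {Ω : ∀ i, Set (Fin (nd i) → ℝ)}
    (hΩ : ∀ i, Convex ℝ (Ω i)) {A : ∀ i, Matrix (Fin m) (Fin (nd i)) ℝ} {btot : Fin m → ℝ}
    (hSlater : ∃ x : ∀ i, Fin (nd i) → ℝ, (∀ i, x i ∈ Ω i) ∧ ∀ j, (∑ i, A i *ᵥ x i) j < btot j)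
    {F : (∀ i, Fin (nd i) → ℝ) → ∀ i, Fin (nd i) → ℝ} {x : ∀ i, Fin (nd i) → ℝ}
    (hx : isVGNE Ω A btot F x) :
    ∃ μ : Fin m → ℝ, (∀ j, 0 ≤ μ j) ∧ μ ⬝ᵥ (∑ i, A i *ᵥ x i - btot) = 0 ∧
      -(F x) - lamT A (fun _ => μ) ∈ nConeB (prodSet Ω) x := by
  obtain ⟨⟨hxΩ, hxA⟩, hvi⟩ := hx
  obtain ⟨x₀, hx₀, hgx₀⟩ := hSlater
  obtain ⟨μ, hμ, hlag⟩ := exists_lagrange_multiplier (C := prodSet Ω)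
    (φ := fun y => bdot (F x) (y - x)) (g := fun j y => (∑ i, A i *ᵥ y i) j - btot j)
    (convexOn_of_map_combo_eq (convex_prodSet hΩ) fun y z a b hab => by
      simp only [bdot_sub_right, bdot_combo]
      linear_combination bdot (F x) x * hab)
    (fun j => convexOn_of_map_combo_eq (convex_prodSet hΩ) fun y z a b hab => by
      rw [sum_mulVec_combo]
      simp only [Pi.add_apply, Pi.smul_apply, smul_eq_mul]
      linear_combination (btot j) * hab)
    ⟨x₀, hx₀, fun j => sub_neg.2 (hgx₀ j)⟩
    (fun y hy hAy => hvi y ⟨hy, fun j => sub_nonpos.1 (hAy j)⟩)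
  have hlag' : ∀ y ∈ prodSet Ω, 0 ≤ bdot (F x) (y - x) + μ ⬝ᵥ (∑ i, A i *ᵥ y i - btot) := hlag
  have hcomp : μ ⬝ᵥ (∑ i, A i *ᵥ x i - btot) = 0 := by
    refine le_antisymm (Finset.sum_nonpos fun j _ =>
      mul_nonpos_of_nonneg_of_nonpos (hμ j) (sub_nonpos.2 (hxA j))) ?_
    have h := hlag' x hxΩ
    rwa [bdot_sub_right, sub_self, zero_add] at h
  refine ⟨μ, hμ, hcomp, hxΩ, fun y hy => ?_⟩
  have h := hlag' y hy
  rw [dotProduct_sub] at h hcomp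
  rw [bdot_sub_left, bdot_neg_left, bdot_sub_right (lamT A _), bdot_lamT_const, bdot_lamT_const]
  linarith

theorem bigV_const {E N m : ℕ} {V : Matrix (Fin E) (Fin N) ℝ} (hV : ∀ l, ∑ j, V l j = 0)
    (μ : Fin m → ℝ) : bigV V (fun _ => μ) = 0 := by
  ext l k
  simp [bigV, ← Finset.sum_mul, hV l]

/-- Rows with exactly one entry `1`, one entry `-1` and zeros elsewhere sum to zero. -/
theorem sum_incidence_row_eq_zero {ι : Type*} [Fintype ι] {v : ι → ℝ}
    (hv : ∃ i j, i ≠ j ∧ v i = 1 ∧ v j = -1 ∧ ∀ t, t ≠ i → t ≠ j → v t = 0) :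
    ∑ t, v t = 0 := by
  obtain ⟨i, j, hij, hi, hj, h⟩ := hv
  rw [Fintype.sum_eq_add i j hij fun t ht => h t ht.1 ht.2, hi, hj, add_neg_cancel]

/-- On a connected graph every stacked vector whose blocks sum to zero is in the range of `𝑽ᵀ`. -/
theorem exists_bigVT_eq {E N m : ℕ} {V : Matrix (Fin E) (Fin N) ℝ}
    (hconn : ∀ y : Fin N → ℝ, V *ᵥ y = 0 → ∃ c : ℝ, ∀ i, y i = c) {z : Fin N → Fin m → ℝ}
    (hz : ∑ i, z i = 0) : ∃ σ : Fin E → Fin m → ℝ, bigVT V σ = z := by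
  have h : ∀ k, ∃ s : Fin E → ℝ, Vᵀ *ᵥ s = fun i => z i k := by
    refine fun k => exists_transpose_mulVec_eq V _ fun y hy => ?_
    obtain ⟨c, hc⟩ := hconn y hy
    have hzk : ∑ i, z i k = 0 := by simpa using congrFun hz k
    simp only [dotProduct, hc, ← Finset.sum_mul, hzk, zero_mul]
  choose s hs using h
  refine ⟨fun l k => s k l, ?_⟩
  ext i k
  rw [← congrFun (hs k) i]
  simp [bigVT, mulVec, dotProduct]

/-- Proposition 1(i): under the standing assumptions, the operator `𝒜 + ℬ` has at
least one zero `ϖ* = (x*, σ*, λ*)`: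
`0 ∈ F(x*) + Λᵀλ* + N_Ω(x*)`, `0 = -ρ 𝑽 λ*`, and
`0 ∈ b̄ - Λx* + ρ 𝑽ᵀ σ* + 𝑳 λ* + N_{ℝ^{mN}_{≥0}}(λ*)`. -/
theorem zeros_of_A_plus_B_nonempty
    {N m E : ℕ} (hN : 2 ≤ N) (hE : 1 ≤ E) {nd : Fin N → ℕ}
    (Ω : ∀ i, Set (Fin (nd i) → ℝ))
    (hΩne : ∀ i, (Ω i).Nonempty) (hΩcp : ∀ i, IsCompact (Ω i)) (hΩcv : ∀ i, Convex ℝ (Ω i))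
    (A : ∀ i, Matrix (Fin m) (Fin (nd i)) ℝ) (b : Fin N → Fin m → ℝ)
    -- Slater's constraint qualification / nonemptiness of 𝒳
    (hSlater : ∃ x : ∀ i, Fin (nd i) → ℝ, (∀ i, x i ∈ Ω i) ∧
      ∀ j, (∑ i, A i *ᵥ x i) j < (∑ i, b i) j)
    -- oriented incidence matrix of an undirected connected graph
    (V : Matrix (Fin E) (Fin N) ℝ)
    (hV : ∀ l, ∃ i j, i ≠ j ∧ V l i = 1 ∧ V l j = -1 ∧ ∀ t, t ≠ i → t ≠ j → V l t = 0)
    (hconn : ∀ y : Fin N → ℝ, V *ᵥ y = 0 → ∃ c : ℝ, ∀ i, y i = c)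
    -- pseudo-gradient: continuous, α-strongly monotone, ℓ-Lipschitz
    (F : (∀ i, Fin (nd i) → ℝ) → ∀ i, Fin (nd i) → ℝ) (hFc : Continuous F)
    (α ℓ : ℝ) (hα : 0 < α) (hℓ : 0 < ℓ)
    (hmono : ∀ x y, α * bdot (x - y) (x - y) ≤ bdot (F x - F y) (x - y))
    (hlip : ∀ x y, bnorm (F x - F y) ≤ ℓ * bnorm (x - y))
    (ρ : ℝ) (hρ : 0 < ρ) :
    ∃ (x : ∀ i, Fin (nd i) → ℝ) (σ : Fin E → Fin m → ℝ) (lam : Fin N → Fin m → ℝ),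
      -- 0 ∈ F(x*) + Λᵀλ* + N_Ω(x*)
      (-(F x) - lamT A lam) ∈ nConeB (prodSet Ω) x ∧
      -- 0 = -ρ 𝑽 λ*
      -(ρ • bigV V lam) = (0 : Fin E → Fin m → ℝ) ∧
      -- 0 ∈ b̄ - Λx* + ρ 𝑽ᵀσ* + 𝑳λ* + N_{ℝ^{mN}_{≥0}}(λ*)
      (lamB A x - b - ρ • bigVT V σ - bigL V lam) ∈ nConeM posOrthM lam := by
  obtain ⟨x₀, hx₀Ω, hx₀A⟩ := hSlater
  obtain ⟨x, hx⟩ : ∃ x, isVGNE Ω A (∑ i, b i) F x :=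
    exists_bdot_variational_inequality_solution (K := feasSet Ω A (∑ i, b i))
      ⟨x₀, hx₀Ω, fun j => (hx₀A j).le⟩
      (isClosed_feasSet (fun i => (hΩcp i).isClosed) A _) (convex_feasSet hΩcv A _) hα hℓ
      hmono hlip
  obtain ⟨μ, hμ, hcomp, hcone⟩ := hx.exists_multiplier hΩcv ⟨x₀, hx₀Ω, hx₀A⟩
  set r : Fin m → ℝ := ∑ i, A i *ᵥ x i - ∑ i, b i with hr
  have hr0 : ∀ j, r j ≤ 0 := fun j => sub_nonpos.2 (hx.1.2 j)
  have hN0 : (N : ℝ) ≠ 0 := Nat.cast_ne_zero.2 (by omega)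
  obtain ⟨σ, hσ⟩ := exists_bigVT_eq hconn
    (z := fun i => ρ⁻¹ • (lamB A x i - b i - (N : ℝ)⁻¹ • r)) <| by
      rw [← Finset.smul_sum, Finset.sum_sub_distrib, Finset.sum_sub_distrib, Finset.sum_const,
        Finset.card_univ, Fintype.card_fin, ← Nat.cast_smul_eq_nsmul ℝ, smul_smul,
        mul_inv_cancel₀ hN0, one_smul, hr]
      simp [lamB]
  have hVμ : bigV V (fun _ => μ) = 0 := bigV_const (fun l => sum_incidence_row_eq_zero (hV l)) μ
  refine ⟨x, σ, fun _ => μ, hcone, by rw [hVμ, smul_zero, neg_zero], fun _ => hμ, fun y hy => ?_⟩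
  have hw : lamB A x - b - ρ • bigVT V σ - bigL V (fun _ => μ) = fun _ => (N : ℝ)⁻¹ • r := by
    ext i k
    simp [bigL, hVμ, hσ, bigVT, mul_inv_cancel_left₀ hρ.ne']
  rw [hw]
  refine Finset.sum_nonpos fun i _ => ?_
  rw [smul_dotProduct, Pi.sub_apply, dotProduct_sub, dotProduct_comm r μ, hcomp, sub_zero]
  exact mul_nonpos_of_nonneg_of_nonpos (by positivity)
    (Finset.sum_nonpos fun j _ => mul_nonpos_of_nonpos_of_nonneg (hr0 j) (hy i j))
end
end

section
/- If ϖ* = (x*, σ*, λ*) ∈ ℝ^n × ℝ^{mE} × ℝ^{mN} satisfies 0 ∈ 𝒜(ϖ*) + ℬ(ϖ*), then the blocks λ*_1, …, λ*_N ∈ ℝ^m of λ* are all equal to a common vector λ̄ ∈ ℝ^m_{≥0}, the pair (x*, λ̄) satisfies the KKT conditions: for every i, 0 ∈ ∇_{x_i} f_i(x*) + A_iᵀ λ̄ + N_{Ω_i}(x*_i), and 0 ∈ b − A x* + N_{ℝ^m_{≥0}}(λ̄); consequently x* is the unique v-GNE of the game, i.e., x* ∈ 𝒳 and ⟨F(x*),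 x − x*⟩ ≥ 0 for all x ∈ 𝒳. (Proposition 1(ii).) -/
open Matrix Filter
open scoped BigOperators

noncomputable section

theorem eq_const_of_bigV_eq_zero {E N m : ℕ} {V : Matrix (Fin E) (Fin N) ℝ}
    (hconn : ∀ y : Fin N → ℝ, V *ᵥ y = 0 → ∃ c : ℝ, ∀ i, y i = c)
    {lam : Fin N → Fin m → ℝ} (h : bigV V lam = 0) :
    ∃ c : Fin m → ℝ, ∀ i, lam i = c := by
  have hcol : ∀ j, ∃ c : ℝ, ∀ i, lam i j = c := fun j => hconn (fun i => lam i j) <| by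
    ext l
    simpa [bigV, Matrix.mulVec, dotProduct] using congrFun (congrFun h l) j
  choose c hc using hcol
  exact ⟨c, fun i => funext fun j => hc j i⟩

/-- Each row of an oriented incidence matrix sums to zero. -/
theorem sum_row_eq_zero {E N : ℕ} {V : Matrix (Fin E) (Fin N) ℝ}
    (hV : ∀ l, ∃ i j, i ≠ j ∧ V l i = 1 ∧ V l j = -1 ∧ ∀ t, t ≠ i → t ≠ j → V l t = 0)
    (l : Fin E) : ∑ i, V l i = 0 := by
  obtain ⟨i, j, hij, hi, hj, h0⟩ := hV l
  rw [Fintype.sum_eq_add i j hij fun t ht => h0 t ht.1 ht.2, hi, hj]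
  norm_num

theorem sum_bigVT_eq_zero {E N m : ℕ} {V : Matrix (Fin E) (Fin N) ℝ}
    (hrow : ∀ l, ∑ i, V l i = 0) (σ : Fin E → Fin m → ℝ) : ∑ i, bigVT V σ i = 0 := by
  simp only [bigVT]
  rw [Finset.sum_comm]
  simp [← Finset.sum_smul, hrow]

/-- A normal vector to the nonnegative orthant is nonpositive and complementary to the point. -/
theorem nonpos_and_dotProduct_eq_zero_of_mem_nCone_posOrthV {m : ℕ} {w lam : Fin m → ℝ}
    (h : w ∈ nCone posOrthV lam) : (∀ j, w j ≤ 0) ∧ w ⬝ᵥ lam = 0 := by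
  obtain ⟨hlam, h⟩ := h
  have hlam' : ∀ j, 0 ≤ lam j := hlam
  refine ⟨fun j => ?_, le_antisymm ?_ ?_⟩
  · have hmem : lam + Pi.single j 1 ∈ (posOrthV : Set (Fin m → ℝ)) := fun k =>
      add_nonneg (hlam' k) ((Pi.single_nonneg.2 zero_le_one : (0 : Fin m → ℝ) ≤ _) k)
    simpa using h _ hmem
  · have hmem : lam + lam ∈ (posOrthV : Set (Fin m → ℝ)) := fun k =>
      add_nonneg (hlam' k) (hlam' k)
    simpa using h _ hmem
  · have hmem : (0 : Fin m → ℝ) ∈ (posOrthV : Set (Fin m → ℝ)) := fun _ => le_rfl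
    simpa using h _ hmem

/-- A normal vector to a product set is blockwise normal. -/
theorem mem_nCone_of_mem_nConeB_prodSet {N : ℕ} {nd : Fin N → ℕ}
    {Ω : ∀ i, Set (Fin (nd i) → ℝ)} {u x : ∀ i, Fin (nd i) → ℝ}
    (h : u ∈ nConeB (prodSet Ω) x) (i : Fin N) : u i ∈ nCone (Ω i) (x i) := by
  obtain ⟨hx, h⟩ := h
  refine ⟨hx i, fun y hy => ?_⟩
  have hmem : Function.update x i y ∈ prodSet Ω := fun k => by
    rcases eq_or_ne k i with rfl | hk
    · simpa using hy
    · simpa [hk] using hx k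
  have hle := h _ hmem
  rw [bdot, Fintype.sum_eq_single i fun k hk => by simp [hk]] at hle
  simpa using hle

/-- A normal vector to `ℝ^{m·K}_{≥0}` at a consensus point has a block sum normal to
`ℝ^m_{≥0}`. -/
theorem sum_mem_nCone_of_mem_nConeM_const {K m : ℕ} {u : Fin K → Fin m → ℝ} {c : Fin m → ℝ}
    (hc : c ∈ posOrthV) (h : u ∈ nConeM posOrthM fun _ => c) : ∑ i, u i ∈ nCone posOrthV c := by
  refine ⟨hc, fun v hv => ?_⟩
  have hle := h.2 (fun _ => v) fun _ j => hv j
  rw [sum_dotProduct]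
  exact hle

/-- The KKT conditions imply the variational inequality. -/
theorem isVGNE_of_kkt {N m : ℕ} {nd : Fin N → ℕ} {Ω : ∀ i, Set (Fin (nd i) → ℝ)}
    {A : ∀ i, Matrix (Fin m) (Fin (nd i)) ℝ} {btot : Fin m → ℝ}
    {F : (∀ i, Fin (nd i) → ℝ) → ∀ i, Fin (nd i) → ℝ} {xs : ∀ i, Fin (nd i) → ℝ}
    {lam : Fin m → ℝ} (hprimal : ∀ i, (-(F xs i) - (A i)ᵀ *ᵥ lam) ∈ nCone (Ω i) (xs i))
    (hdual : (∑ i, A i *ᵥ xs i) - btot ∈ nCone posOrthV lam) : isVGNE Ω A btot F xs := by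
  obtain ⟨hfeas, hcompl⟩ := nonpos_and_dotProduct_eq_zero_of_mem_nCone_posOrthV hdual
  refine ⟨⟨fun i => (hprimal i).1, fun j => by simpa using hfeas j⟩, fun x hx => ?_⟩
  have hsum : ∑ i, (-(F xs i) - (A i)ᵀ *ᵥ lam) ⬝ᵥ (x i - xs i) ≤ 0 :=
    Finset.sum_nonpos fun i _ => (hprimal i).2 _ (hx.1 i)
  have hadj : ∀ i, ((A i)ᵀ *ᵥ lam) ⬝ᵥ (x i - xs i) = (A i *ᵥ x i - A i *ᵥ xs i) ⬝ᵥ lam := by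
    intro i
    rw [mulVec_transpose, ← dotProduct_mulVec, mulVec_sub, dotProduct_comm]
  have hle : ((∑ i, A i *ᵥ x i) - btot) ⬝ᵥ lam ≤ 0 :=
    Finset.sum_nonpos fun j _ =>
      mul_nonpos_of_nonpos_of_nonneg (by simpa using hx.2 j) (hdual.1 j)
  simp only [sub_dotProduct, neg_dotProduct, hadj, Finset.sum_sub_distrib, Finset.sum_neg_distrib,
    ← sum_dotProduct] at hsum hle hcompl
  have hgoal : bdot (F xs) (x - xs) = ∑ i, F xs i ⬝ᵥ (x i - xs i) := rfl
  linarith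

theorem eq_zero_of_bdot_self_nonpos {N : ℕ} {nd : Fin N → ℕ} {u : ∀ i, Fin (nd i) → ℝ}
    (h : bdot u u ≤ 0) : u = 0 := by
  have hnn : ∀ i, 0 ≤ u i ⬝ᵥ u i := fun i => Finset.sum_nonneg fun k _ => mul_self_nonneg _
  have hz := (Finset.sum_eq_zero_iff_of_nonneg fun i _ => hnn i).1
    (le_antisymm h (Finset.sum_nonneg fun i _ => hnn i))
  exact funext fun i => dotProduct_self_eq_zero.1 (hz i (Finset.mem_univ i))

/-- A strongly monotone variational inequality has at most one solution. -/
theorem isVGNE_unique {N m : ℕ} {nd : Fin N → ℕ} {Ω : ∀ i, Set (Fin (nd i) → ℝ)}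
    {A : ∀ i, Matrix (Fin m) (Fin (nd i)) ℝ} {btot : Fin m → ℝ}
    {F : (∀ i, Fin (nd i) → ℝ) → ∀ i, Fin (nd i) → ℝ} {α : ℝ} (hα : 0 < α)
    (hmono : ∀ x y, α * bdot (x - y) (x - y) ≤ bdot (F x - F y) (x - y))
    {x y : ∀ i, Fin (nd i) → ℝ} (hx : isVGNE Ω A btot F x) (hy : isVGNE Ω A btot F y) :
    y = x := by
  have hxy := hx.2 y hy.1
  have hyx := hy.2 x hx.1
  have hexp : bdot (F y - F x) (y - x) = -bdot (F y) (x - y) - bdot (F x) (y - x) := by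
    simp only [bdot, Pi.sub_apply, sub_dotProduct, dotProduct_sub, Finset.sum_sub_distrib]
    ring
  have hle : α * bdot (y - x) (y - x) ≤ 0 := (hmono y x).trans (by linarith)
  exact sub_eq_zero.1 (eq_zero_of_bdot_self_nonpos (nonpos_of_mul_nonpos_right hle hα))

/-- Proposition 1(ii): any zero `ϖ* = (x*, σ*, λ*)` of `𝒜 + ℬ` has all dual blocks
equal to a common `λ̄ ∈ ℝ^m_{≥0}`, the pair `(x*, λ̄)` satisfies the KKT conditions, and `x*` is
the unique v-GNE of the game. -/
theorem zero_of_A_plus_B_is_vGNE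
    {N m E : ℕ} (hN : 2 ≤ N) (hE : 1 ≤ E) {nd : Fin N → ℕ}
    (Ω : ∀ i, Set (Fin (nd i) → ℝ))
    (hΩne : ∀ i, (Ω i).Nonempty) (hΩcp : ∀ i, IsCompact (Ω i)) (hΩcv : ∀ i, Convex ℝ (Ω i))
    (A : ∀ i, Matrix (Fin m) (Fin (nd i)) ℝ) (b : Fin N → Fin m → ℝ)
    (hSlater : ∃ x : ∀ i, Fin (nd i) → ℝ, (∀ i, x i ∈ Ω i) ∧
      ∀ j, (∑ i, A i *ᵥ x i) j < (∑ i, b i) j)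
    (V : Matrix (Fin E) (Fin N) ℝ)
    (hV : ∀ l, ∃ i j, i ≠ j ∧ V l i = 1 ∧ V l j = -1 ∧ ∀ t, t ≠ i → t ≠ j → V l t = 0)
    (hconn : ∀ y : Fin N → ℝ, V *ᵥ y = 0 → ∃ c : ℝ, ∀ i, y i = c)
    (F : (∀ i, Fin (nd i) → ℝ) → ∀ i, Fin (nd i) → ℝ) (hFc : Continuous F)
    (α ℓ : ℝ) (hα : 0 < α) (hℓ : 0 < ℓ)
    (hmono : ∀ x y, α * bdot (x - y) (x - y) ≤ bdot (F x - F y) (x - y))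
    (hlip : ∀ x y, bnorm (F x - F y) ≤ ℓ * bnorm (x - y))
    (ρ : ℝ) (hρ : 0 < ρ)
    -- ϖ* = (x*, σ*, λ*) is a zero of 𝒜 + ℬ:
    (xs : ∀ i, Fin (nd i) → ℝ) (σs : Fin E → Fin m → ℝ) (lams : Fin N → Fin m → ℝ)
    (hzero₁ : (-(F xs) - lamT A lams) ∈ nConeB (prodSet Ω) xs)
    (hzero₂ : -(ρ • bigV V lams) = (0 : Fin E → Fin m → ℝ))
    (hzero₃ : (lamB A xs - b - ρ • bigVT V σs - bigL V lams) ∈ nConeM posOrthM lams) :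
    ∃ lamBar : Fin m → ℝ,
      -- all dual blocks agree and are nonnegative
      (∀ i, lams i = lamBar) ∧ lamBar ∈ posOrthV ∧
      -- KKT conditions: 0 ∈ ∇_{x_i} f_i(x*) + A_iᵀ λ̄ + N_{Ω_i}(x*_i) for every i
      (∀ i, (-(F xs i) - (A i)ᵀ *ᵥ lamBar) ∈ nCone (Ω i) (xs i)) ∧
      -- and 0 ∈ b - A x* + N_{ℝ^m_{≥0}}(λ̄)
      ((∑ i, A i *ᵥ xs i) - (∑ i, b i)) ∈ nCone posOrthV lamBar ∧
      -- x* is the unique v-GNE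
      isVGNE Ω A (∑ i, b i) F xs ∧ (∀ y, isVGNE Ω A (∑ i, b i) F y → y = xs) := by
  have hbigV : bigV V lams = 0 := (smul_eq_zero.1 (neg_eq_zero.1 hzero₂)).resolve_left hρ.ne'
  obtain ⟨c, hc⟩ := eq_const_of_bigV_eq_zero hconn hbigV
  obtain rfl : lams = fun _ => c := funext hc
  have hcnn : c ∈ posOrthV := hzero₃.1 ⟨0, by omega⟩
  have hrow := sum_row_eq_zero hV
  have hprimal : ∀ i, (-(F xs i) - (A i)ᵀ *ᵥ c) ∈ nCone (Ω i) (xs i) :=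
    mem_nCone_of_mem_nConeB_prodSet hzero₁
  have hdual : (∑ i, A i *ᵥ xs i) - (∑ i, b i) ∈ nCone posOrthV c := by
    have h := sum_mem_nCone_of_mem_nConeM_const hcnn hzero₃
    simpa [Finset.sum_sub_distrib, ← Finset.smul_sum, bigL, sum_bigVT_eq_zero hrow, lamB] using h
  have hsol := isVGNE_of_kkt hprimal hdual
  exact ⟨c, fun _ => rfl, hcnn, hprimal, hdual, hsol, fun y hy => isVGNE_unique hα hmono hsol hy⟩
end
end

section
/- The map ℬ is χ-cocoercive with χ := min{α/ℓ², λ_max(L)^{−1}}: for all ϖ₁, ϖ₂ ∈ ℝ^n × ℝ^{mE} × ℝ^{mN}, ⟨ℬ(ϖ₁) − ℬ(ϖ₂), ϖ₁ − ϖ₂⟩ ≥ χ ‖ℬ(ϖ₁) − ℬ(ϖ₂)‖². (Lemma 1, second part.) -/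
open Matrix Filter
open scoped BigOperators

noncomputable section

/-- The state space `ℝ^d = ℝ^n × ℝ^{mE} × ℝ^{mN}` for `ϖ = (x, σ, λ)`. -/
abbrev GState (N E m : ℕ) (nd : Fin N → ℕ) :=
  (∀ i, Fin (nd i) → ℝ) × (Fin E → Fin m → ℝ) × (Fin N → Fin m → ℝ)

/-- Euclidean inner product on the state space. -/
def gdot {N E m : ℕ} {nd : Fin N → ℕ} (u v : GState N E m nd) : ℝ :=
  bdot u.1 v.1 + mdot u.2.1 v.2.1 + mdot u.2.2 v.2.2

/-- The single-valued operator `ℬ(x,σ,λ) = (F(x), 0, b̄ + 𝑳λ)`. -/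
def Bmap {N E m : ℕ} {nd : Fin N → ℕ}
    (F : (∀ i, Fin (nd i) → ℝ) → ∀ i, Fin (nd i) → ℝ)
    (b : Fin N → Fin m → ℝ) (V : Matrix (Fin E) (Fin N) ℝ)
    (w : GState N E m nd) : GState N E m nd :=
  (F w.1, 0, b + bigL V w.2.2)

/-- A Hermitian real matrix whose eigenvalues are all at most `c` satisfies
`⟨u, M u⟩ ≤ c ‖u‖²`. -/
theorem dotProduct_mulVec_le_of_eigenvalue_le {ι : Type*} [Fintype ι] [DecidableEq ι]
    {M : Matrix ι ι ℝ} (hM : M.IsHermitian) {c : ℝ}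
    (hc : ∀ (μ : ℝ) (v : ι → ℝ), v ≠ 0 → M *ᵥ v = μ • v → μ ≤ c) (u : ι → ℝ) :
    u ⬝ᵥ M *ᵥ u ≤ c * (u ⬝ᵥ u) := by
  have hH : (c • (1 : Matrix ι ι ℝ) - M).IsHermitian :=
    (isHermitian_one.smul (IsSelfAdjoint.all c)).sub hM
  have hpsd : (c • (1 : Matrix ι ι ℝ) - M).PosSemidef := by
    refine hH.posSemidef_iff_eigenvalues_nonneg.mpr fun i => ?_
    have hv := hH.mulVec_eigenvectorBasis i
    set v : ι → ℝ := (hH.eigenvectorBasis i).ofLp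
    have hv0 : v ≠ 0 := fun h =>
      hH.eigenvectorBasis.orthonormal.ne_zero i ((WithLp.ofLp_eq_zero 2).mp h)
    have hle : c - hH.eigenvalues i ≤ c := by
      refine hc _ v hv0 ?_
      rw [sub_mulVec, smul_mulVec, one_mulVec] at hv
      rw [sub_smul, ← hv, sub_sub_cancel]
    simpa using hle
  have h := hpsd.dotProduct_mulVec_nonneg u
  rw [sub_mulVec, smul_mulVec, one_mulVec, dotProduct_sub, dotProduct_smul, star_trivial,
    smul_eq_mul] at h
  linarith

/-- If every eigenvalue of the Gram matrix `VᵀV` is at most `c > 0`, then `VᵀV` is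
`c⁻¹`-cocoercive. -/
theorem gram_cocoercive {ι κ : Type*} [Fintype ι] [DecidableEq ι] [Fintype κ]
    (V : Matrix κ ι ℝ) {c : ℝ} (hcpos : 0 < c)
    (hc : ∀ (μ : ℝ) (v : ι → ℝ), v ≠ 0 → (Vᵀ * V) *ᵥ v = μ • v → μ ≤ c) (v : ι → ℝ) :
    c⁻¹ * ((Vᵀ *ᵥ V *ᵥ v) ⬝ᵥ (Vᵀ *ᵥ V *ᵥ v)) ≤ (Vᵀ *ᵥ V *ᵥ v) ⬝ᵥ v := by
  have hH : (Vᵀ * V).IsHermitian := by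
    simpa using isHermitian_conjTranspose_mul_self V
  have hadj : ∀ (a : κ → ℝ) (x : ι → ℝ), (Vᵀ *ᵥ a) ⬝ᵥ x = a ⬝ᵥ V *ᵥ x := fun a x => by
    rw [mulVec_transpose, dotProduct_mulVec]
  set w := V *ᵥ v
  set u := Vᵀ *ᵥ w
  have hbound := dotProduct_mulVec_le_of_eigenvalue_le hH hc u
  rw [← mulVec_mulVec, dotProduct_comm, hadj] at hbound
  have hcross : w ⬝ᵥ V *ᵥ u = u ⬝ᵥ u := (hadj w u).symm
  have hsq : 0 ≤ (w - c⁻¹ • V *ᵥ u) ⬝ᵥ (w - c⁻¹ • V *ᵥ u) :=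
    Finset.sum_nonneg fun _ _ => mul_self_nonneg _
  simp only [sub_dotProduct, dotProduct_sub, smul_dotProduct, dotProduct_smul, smul_eq_mul,
    dotProduct_comm (V *ᵥ u) w, hcross] at hsq
  have hscaled : c⁻¹ * (c⁻¹ * (V *ᵥ u ⬝ᵥ V *ᵥ u)) ≤ c⁻¹ * (u ⬝ᵥ u) := by
    have hinv : 0 ≤ c⁻¹ := (inv_pos.mpr hcpos).le
    calc c⁻¹ * (c⁻¹ * (V *ᵥ u ⬝ᵥ V *ᵥ u)) ≤ c⁻¹ * (c⁻¹ * (c * (u ⬝ᵥ u))) := by gcongr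
      _ = c⁻¹ * (u ⬝ᵥ u) := by rw [inv_mul_cancel_left₀ hcpos.ne']
  have huv : u ⬝ᵥ v = w ⬝ᵥ w := hadj w v
  linarith

theorem mdot_eq_sum_columns {K m : ℕ} (u v : Fin K → Fin m → ℝ) :
    mdot u v = ∑ k, (fun i => u i k) ⬝ᵥ (fun i => v i k) :=
  Finset.sum_comm

theorem bigL_column {E N m : ℕ} (V : Matrix (Fin E) (Fin N) ℝ) (lam : Fin N → Fin m → ℝ)
    (k : Fin m) :
    (fun i => bigL V lam i k) = Vᵀ *ᵥ V *ᵥ fun i => lam i k := by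
  ext i
  simp [bigL, bigVT, bigV, mulVec, dotProduct, Finset.sum_apply]

theorem bigL_sub {E N m : ℕ} (V : Matrix (Fin E) (Fin N) ℝ) (lam mu : Fin N → Fin m → ℝ) :
    bigL V lam - bigL V mu = bigL V (lam - mu) := by
  ext i k
  simp [bigL, bigVT, bigV, Finset.sum_apply, mul_sub, Finset.sum_sub_distrib]

theorem bigL_cocoercive {E N m : ℕ} (V : Matrix (Fin E) (Fin N) ℝ) {c : ℝ} (hcpos : 0 < c)
    (hc : ∀ (μ : ℝ) (v : Fin N → ℝ), v ≠ 0 → (Vᵀ * V) *ᵥ v = μ • v → μ ≤ c)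
    (lam : Fin N → Fin m → ℝ) :
    c⁻¹ * mdot (bigL V lam) (bigL V lam) ≤ mdot (bigL V lam) lam := by
  simp only [mdot_eq_sum_columns, bigL_column, Finset.mul_sum]
  exact Finset.sum_le_sum fun k _ => gram_cocoercive V hcpos hc _

theorem bdot_self_nonneg {N : ℕ} {nd : Fin N → ℕ} (u : ∀ i, Fin (nd i) → ℝ) :
    0 ≤ bdot u u :=
  Finset.sum_nonneg fun _ _ => Finset.sum_nonneg fun _ _ => mul_self_nonneg _

theorem mdot_self_nonneg {K m : ℕ} (u : Fin K → Fin m → ℝ) : 0 ≤ mdot u u :=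
  Finset.sum_nonneg fun _ _ => Finset.sum_nonneg fun _ _ => mul_self_nonneg _

/-- A strongly monotone Lipschitz map is cocoercive. -/
theorem cocoercive_of_strongly_monotone_of_lipschitz {N : ℕ} {nd : Fin N → ℕ}
    {F : (∀ i, Fin (nd i) → ℝ) → ∀ i, Fin (nd i) → ℝ} {α ℓ : ℝ} (hα : 0 < α) (hℓ : 0 < ℓ)
    (hmono : ∀ x y, α * bdot (x - y) (x - y) ≤ bdot (F x - F y) (x - y))
    (hlip : ∀ x y, bnorm (F x - F y) ≤ ℓ * bnorm (x - y)) (x y : ∀ i, Fin (nd i) → ℝ) :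
    α / ℓ ^ 2 * bdot (F x - F y) (F x - F y) ≤ bdot (F x - F y) (x - y) := by
  have hsq : bdot (F x - F y) (F x - F y) ≤ ℓ ^ 2 * bdot (x - y) (x - y) := by
    have h := pow_le_pow_left₀ (Real.sqrt_nonneg _) (hlip x y) 2
    simp only [bnorm] at h
    rwa [mul_pow, Real.sq_sqrt (bdot_self_nonneg _),
      Real.sq_sqrt (bdot_self_nonneg _)] at h
  calc α / ℓ ^ 2 * bdot (F x - F y) (F x - F y)
      ≤ α / ℓ ^ 2 * (ℓ ^ 2 * bdot (x - y) (x - y)) := by gcongr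
    _ = α * bdot (x - y) (x - y) := by field_simp
    _ ≤ bdot (F x - F y) (x - y) := hmono x y

/-- Lemma 1, second part: `ℬ` is `χ`-cocoercive with
`χ = min{α/ℓ², λ_max(L)⁻¹}`. -/
theorem B_cocoercive
    {N m E : ℕ} (hN : 2 ≤ N) (hE : 1 ≤ E) {nd : Fin N → ℕ}
    (F : (∀ i, Fin (nd i) → ℝ) → ∀ i, Fin (nd i) → ℝ)
    (α ℓ : ℝ) (hα : 0 < α) (hℓ : 0 < ℓ)
    (hmono : ∀ x y, α * bdot (x - y) (x - y) ≤ bdot (F x - F y) (x - y))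
    (hlip : ∀ x y, bnorm (F x - F y) ≤ ℓ * bnorm (x - y))
    (V : Matrix (Fin E) (Fin N) ℝ)
    (hV : ∀ l, ∃ i j, i ≠ j ∧ V l i = 1 ∧ V l j = -1 ∧ ∀ t, t ≠ i → t ≠ j → V l t = 0)
    -- λ_max(L) > 0: the largest eigenvalue of the (nonzero) Laplacian L = VᵀV
    (lmax : ℝ) (hlpos : 0 < lmax)
    (h_eig : ∃ v : Fin N → ℝ, v ≠ 0 ∧ (Vᵀ * V) *ᵥ v = lmax • v)
    (h_max : ∀ (μ : ℝ) (v : Fin N → ℝ), v ≠ 0 → (Vᵀ * V) *ᵥ v = μ • v → μ ≤ lmax)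
    (b : Fin N → Fin m → ℝ) :
    ∀ w₁ w₂ : GState N E m nd,
      min (α / ℓ ^ 2) lmax⁻¹ *
          gdot (Bmap F b V w₁ - Bmap F b V w₂) (Bmap F b V w₁ - Bmap F b V w₂) ≤
        gdot (Bmap F b V w₁ - Bmap F b V w₂) (w₁ - w₂) := by
  intro w₁ w₂
  have hF := cocoercive_of_strongly_monotone_of_lipschitz hα hℓ hmono hlip w₁.1 w₂.1
  have hL := bigL_cocoercive V hlpos h_max (w₁.2.2 - w₂.2.2)
  have hFmin := mul_le_mul_of_nonneg_right (min_le_left (α / ℓ ^ 2) lmax⁻¹)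
    (bdot_self_nonneg (F w₁.1 - F w₂.1))
  have hLmin := mul_le_mul_of_nonneg_right (min_le_right (α / ℓ ^ 2) lmax⁻¹)
    (mdot_self_nonneg (bigL V (w₁.2.2 - w₂.2.2)))
  have hzero : ∀ s : Fin E → Fin m → ℝ, mdot 0 s = 0 := fun s => by simp [mdot]
  simp only [gdot, Bmap, Prod.fst_sub, Prod.snd_sub, sub_self, hzero, add_sub_add_left_eq_sub,
    bigL_sub, mul_add, mul_zero]
  linarith
end
end

section
/- Let Φ ∈ ℝ^{d×d} be symmetric with Φ − θI_d positive semidefinite for some θ > 0, let 𝒜 : ℝ^d ⇉ ℝ^d be a monotone set-valued operator (⟨u − u', w − w'⟩ ≥ 0 whenever u ∈ 𝒜(w), u' ∈ 𝒜(w')), let ℬ : ℝ^d → ℝ^d be χ-cocoercive (⟨ℬ(x) − ℬ(y), x − y⟩ ≥ χ‖ℬ(x) − ℬ(y)‖² for all x, y) with χθ > 1/2, and let T : ℝ^d → ℝ^d satisfy Φ(ϖ − T(ϖ)) ∈ 𝒜(T(ϖ)) + ℬ(ϖ) for every ϖ ∈ ℝ^d. Then T is η'-averaged in the Φ-norm with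 η' := 2χθ/(4χθ − 1) ∈ (0,1): for all ϖ₁, ϖ₂ ∈ ℝ^d, ‖T(ϖ₁) − T(ϖ₂)‖²_Φ ≤ ‖ϖ₁ − ϖ₂‖²_Φ − ((1 − η')/η') ‖(ϖ₁ − T(ϖ₁)) − (ϖ₂ − T(ϖ₂))‖²_Φ. (Averagedness of the preconditioned forward–backward operator, used in the proofs of Theorems 2 and 3.) -/
open Matrix

/-- averagedness, in the `Φ`-norm, of the preconditioned forward–backward
operator `T`, characterized by `Φ(ϖ - Tϖ) ∈ 𝒜(Tϖ) + ℬ(ϖ)`, where `𝒜` is monotone and `ℬ` is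
`χ`-cocoercive with `χθ > 1/2`: `T` is `η'`-averaged with `η' := 2χθ/(4χθ - 1) ∈ (0,1)`. -/
theorem preconditioned_forward_backward_averaged
    {d : ℕ} (Φ : Matrix (Fin d) (Fin d) ℝ) (θ χ : ℝ) (hθ : 0 < θ) (hχ : 0 < χ)
    (hΦsym : Φ.IsSymm)
    (hΦ : (Φ - θ • (1 : Matrix (Fin d) (Fin d) ℝ)).PosSemidef)
    (A : (Fin d → ℝ) → Set (Fin d → ℝ))
    (hA : ∀ w w' u u' : Fin d → ℝ, u ∈ A w → u' ∈ A w' → 0 ≤ (u - u') ⬝ᵥ (w - w'))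
    (B : (Fin d → ℝ) → (Fin d → ℝ))
    (hB : ∀ x y : Fin d → ℝ, χ * ((B x - B y) ⬝ᵥ (B x - B y)) ≤ (B x - B y) ⬝ᵥ (x - y))
    (hχθ : 1 / 2 < χ * θ)
    (T : (Fin d → ℝ) → (Fin d → ℝ))
    (hT : ∀ w : Fin d → ℝ, Φ *ᵥ (w - T w) - B w ∈ A (T w)) :
    (0 < 2 * χ * θ / (4 * χ * θ - 1) ∧ 2 * χ * θ / (4 * χ * θ - 1) < 1) ∧
    ∀ w₁ w₂ : Fin d → ℝ,
      (T w₁ - T w₂) ⬝ᵥ (Φ *ᵥ (T w₁ - T w₂)) ≤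
        (w₁ - w₂) ⬝ᵥ (Φ *ᵥ (w₁ - w₂)) -
          ((1 - 2 * χ * θ / (4 * χ * θ - 1)) / (2 * χ * θ / (4 * χ * θ - 1))) *
            (((w₁ - T w₁) - (w₂ - T w₂)) ⬝ᵥ (Φ *ᵥ ((w₁ - T w₁) - (w₂ - T w₂)))) := by
  have hd : 0 < 4 * χ * θ - 1 := by linarith
  have hn : 0 < 2 * χ * θ := by positivity
  refine ⟨⟨div_pos hn hd, (div_lt_one hd).2 (by linarith)⟩, fun w₁ w₂ => ?_⟩
  have hcoef : (1 - 2 * χ * θ / (4 * χ * θ - 1)) / (2 * χ * θ / (4 * χ * θ - 1))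
      = 1 - 1 / (2 * χ * θ) := by
    rw [one_sub_div hd.ne', div_div_div_cancel_right₀ hd.ne', one_sub_div hn.ne']
    ring
  rw [hcoef]
  have hmono := hA _ _ _ _ (hT w₁) (hT w₂)
  have hcoco := hB w₁ w₂
  obtain ⟨t, ht⟩ : ∃ t, t = T w₁ - T w₂ := ⟨_, rfl⟩
  obtain ⟨r, hr⟩ : ∃ r, r = (w₁ - T w₁) - (w₂ - T w₂) := ⟨_, rfl⟩
  obtain ⟨b, hb⟩ : ∃ b, b = B w₁ - B w₂ := ⟨_, rfl⟩
  have hw : w₁ - w₂ = t + r := by rw [ht, hr]; abel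
  have hu : Φ *ᵥ (w₁ - T w₁) - B w₁ - (Φ *ᵥ (w₂ - T w₂) - B w₂) = Φ *ᵥ r - b := by
    rw [hr, hb, mulVec_sub Φ (w₁ - T w₁)]; abel
  rw [hu, ← ht, sub_dotProduct, dotProduct_comm (Φ *ᵥ r)] at hmono
  rw [← hb, hw, dotProduct_add] at hcoco
  rw [← ht, ← hr, hw]
  have hsymm : r ⬝ᵥ (Φ *ᵥ t) = t ⬝ᵥ (Φ *ᵥ r) := by
    rw [dotProduct_mulVec, ← mulVec_transpose, hΦsym.eq, dotProduct_comm]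
  have hlower : θ * (r ⬝ᵥ r) ≤ r ⬝ᵥ (Φ *ᵥ r) := by
    have h := hΦ.dotProduct_mulVec_nonneg r
    simp only [star_trivial, sub_mulVec, smul_mulVec, one_mulVec, dotProduct_sub,
      dotProduct_smul, smul_eq_mul] at h
    linarith
  have hsquare : 0 ≤ 4 * χ ^ 2 * (b ⬝ᵥ b) - 4 * χ * (b ⬝ᵥ r) + r ⬝ᵥ r := by
    have h : 0 ≤ ((2 * χ) • b - r) ⬝ᵥ ((2 * χ) • b - r) :=
      Finset.sum_nonneg fun i _ => mul_self_nonneg _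
    simp only [sub_dotProduct, dotProduct_sub, smul_dotProduct, dotProduct_smul,
      smul_eq_mul, dotProduct_comm r b] at h
    linarith
  have hyoung : 0 ≤ 2 * χ * (b ⬝ᵥ b) - 2 * (b ⬝ᵥ r) + 1 / (2 * χ * θ) * (r ⬝ᵥ (Φ *ᵥ r)) := by
    have h : 2 * χ * (b ⬝ᵥ b) - 2 * (b ⬝ᵥ r) + 1 / (2 * χ * θ) * (r ⬝ᵥ (Φ *ᵥ r))
        = (θ * (4 * χ ^ 2 * (b ⬝ᵥ b) - 4 * χ * (b ⬝ᵥ r) + r ⬝ᵥ r)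
          + (r ⬝ᵥ (Φ *ᵥ r) - θ * (r ⬝ᵥ r))) / (2 * χ * θ) := by
      field_simp
      ring
    rw [h]
    exact div_nonneg (add_nonneg (mul_nonneg hθ.le hsquare) (sub_nonneg.2 hlower)) hn.le
  simp only [mulVec_add, dotProduct_add, add_dotProduct, hsymm]
  linarith
end
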